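/- (First contiguous relation for the Andrews/Li–Chu ₄φ₃ sums) Let n ≥ 1 be an integer, let p be a nonzero complex number and set q = p², and let b, d be complex numbers with b ≠ 0 such that (q;q)_n ≠ 0, (dq;q)_{n+1} ≠ 0, (dp;q)_{n+1} ≠ 0, (b²;q)_{n+2} ≠ 0, 1 + b ≠ 0, and 1 + bp ≠ 0. Define A_n(b,d;q) := ∑_{j=0}^{n} ((q^{-n};q)_j (b;q)_j (bp;q)_j (d²q^n;q)_j / ((q;q)_j (dq;q)_j (dp;q)_j (b²;q)_j)) q^j and B_n(b,d;q) := ∑_{j=0}^{n} ((q^{-n};q)_j (b;q)_j (bp;q)_j (d²q^{n+1};q)_j / ((q;q)_j (dq;q)_j (dp;q)_j (b²q;q)_j)) q^j. Then B_n(b,d;q) − A_n(b,d;q) = − (q(b² − d²q^n)(1 − q^{-n}) / ((1+b)(1+bp)(1−dq)(1−dp))) · A_{n−1}(bq, dq; q), where A_{n−1}(bq,dq;q) is A with b replaced by bq, d replaced by dq, and n replaced by n−1. -/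

import Mathlib

/-- The $q$-shifted factorial $(a;q)_m = \prod_{k=0}^{m-1}(1 - a q^k)$. -/
noncomputable def qPoch (q a : ℂ) (m : ℕ) : ℂ := ∏ k ∈ Finset.range m, (1 - a * q ^ k)

/-- The first Andrews/Li–Chu ${}_4\phi_3$ sum $A_n(b,d;q)$ with $q = p^2$. -/
noncomputable def A4 (p b d : ℂ) (n : ℕ) : ℂ :=
  ∑ j ∈ Finset.range (n + 1),
    qPoch (p ^ 2) ((p ^ 2) ^ (-(n : ℤ))) j * qPoch (p ^ 2) b j * qPoch (p ^ 2) (b * p) j *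
      qPoch (p ^ 2) (d ^ 2 * (p ^ 2) ^ n) j /
      (qPoch (p ^ 2) (p ^ 2) j * qPoch (p ^ 2) (d * p ^ 2) j * qPoch (p ^ 2) (d * p) j *
        qPoch (p ^ 2) (b ^ 2) j) * (p ^ 2) ^ j

/-- The second Andrews/Li–Chu ${}_4\phi_3$ sum $B_n(b,d;q)$ with $q = p^2$. -/
noncomputable def B4 (p b d : ℂ) (n : ℕ) : ℂ :=
  ∑ j ∈ Finset.range (n + 1),
    qPoch (p ^ 2) ((p ^ 2) ^ (-(n : ℤ))) j * qPoch (p ^ 2) b j * qPoch (p ^ 2) (b * p) j *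
      qPoch (p ^ 2) (d ^ 2 * (p ^ 2) ^ (n + 1)) j /
      (qPoch (p ^ 2) (p ^ 2) j * qPoch (p ^ 2) (d * p ^ 2) j * qPoch (p ^ 2) (d * p) j *
        qPoch (p ^ 2) (b ^ 2 * p ^ 2) j) * (p ^ 2) ^ j

theorem qPoch_zero (q a : ℂ) : qPoch q a 0 = 1 := Finset.prod_range_zero _

theorem qPoch_succ (q a : ℂ) (m : ℕ) : qPoch q a (m + 1) = qPoch q a m * (1 - a * q ^ m) :=
  Finset.prod_range_succ _ _

theorem qPoch_succ_left (q a : ℂ) (m : ℕ) :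
    qPoch q a (m + 1) = (1 - a) * qPoch q (a * q) m := by
  simp only [qPoch, Finset.prod_range_succ', pow_zero, mul_one, pow_succ']
  rw [mul_comm]
  simp only [mul_assoc]

theorem qPoch_ne_zero_of_le {q a : ℂ} {m k : ℕ} (hmk : m ≤ k) (h : qPoch q a k ≠ 0) :
    qPoch q a m ≠ 0 := by
  rw [qPoch, Finset.prod_ne_zero_iff] at h ⊢
  exact fun i hi => h i (Finset.range_subset_range.2 hmk hi)

/-- Shifting both parameters of a ratio of $q$-shifted factorials by `q`. -/
theorem qPoch_ratio_shift_sub (q x c : ℂ) (i : ℕ) (h : qPoch q c (i + 2) ≠ 0) :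
    qPoch q (x * q) (i + 1) / qPoch q (c * q) (i + 1) - qPoch q x (i + 1) / qPoch q c (i + 1)
      = (x - c) * (1 - q * q ^ i) / ((1 - c) * (1 - c * q))
          * (qPoch q (x * q) i / qPoch q (c * q * q) i) := by
  have e : qPoch q c (i + 2) = (1 - c) * ((1 - c * q) * qPoch q (c * q * q) i) := by
    rw [qPoch_succ_left, qPoch_succ_left]
  have f : qPoch q c (i + 2) = qPoch q c (i + 1) * (1 - c * q ^ (i + 1)) := qPoch_succ _ _ _
  have hf := f ▸ h
  obtain ⟨hF, hG⟩ := mul_ne_zero_iff.1 hf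
  have he := e ▸ h
  obtain ⟨hc, hcq, hE⟩ : 1 - c ≠ 0 ∧ 1 - c * q ≠ 0 ∧ qPoch q (c * q * q) i ≠ 0 := by
    simpa only [mul_ne_zero_iff] using he
  have hF' : qPoch q c (i + 1)
      = (1 - c) * ((1 - c * q) * qPoch q (c * q * q) i) / (1 - c * q ^ (i + 1)) := by
    rw [eq_div_iff hG, ← f, e]
  rw [hF', qPoch_succ_left q (c * q), qPoch_succ_left q x, qPoch_succ q (x * q)]
  field_simp
  ring

/-- First contiguous relation for the Andrews/Li–Chu ${}_4\phi_3$ sums. -/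
theorem first_contiguous (n : ℕ) (hn : 1 ≤ n) (p b d : ℂ) (hp : p ≠ 0) (hb : b ≠ 0)
    (h1 : qPoch (p ^ 2) (p ^ 2) n ≠ 0) (h2 : qPoch (p ^ 2) (d * p ^ 2) (n + 1) ≠ 0)
    (h3 : qPoch (p ^ 2) (d * p) (n + 1) ≠ 0) (h4 : qPoch (p ^ 2) (b ^ 2) (n + 2) ≠ 0)
    (h5 : 1 + b ≠ 0) (h6 : 1 + b * p ≠ 0) :
    B4 p b d n - A4 p b d n
      = -(p ^ 2 * (b ^ 2 - d ^ 2 * (p ^ 2) ^ n) * (1 - (p ^ 2) ^ (-(n : ℤ))) /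
          ((1 + b) * (1 + b * p) * (1 - d * p ^ 2) * (1 - d * p)))
          * A4 p (b * p ^ 2) (d * p ^ 2) (n - 1) := by
  obtain ⟨m, rfl⟩ : ∃ m, n = m + 1 := ⟨n - 1, by omega⟩
  have hq : p ^ 2 ≠ 0 := pow_ne_zero 2 hp
  rw [B4, A4, A4, Finset.sum_range_succ', Finset.sum_range_succ' _ (m + 1), Nat.add_sub_cancel]
  simp only [qPoch_zero, add_sub_add_right_eq_sub]
  rw [← Finset.sum_sub_distrib, Finset.mul_sum]
  refine Finset.sum_congr rfl fun i hi => ?_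
  have hi' : i ≤ m := by simpa [Nat.lt_succ_iff] using hi
  have g1 := qPoch_ne_zero_of_le (show i + 1 ≤ m + 1 by omega) h1
  have g2 := qPoch_ne_zero_of_le (show i + 1 ≤ m + 1 + 1 by omega) h2
  have g3 := qPoch_ne_zero_of_le (show i + 1 ≤ m + 1 + 1 by omega) h3
  have g4 := qPoch_ne_zero_of_le (show i + 2 ≤ m + 1 + 2 by omega) h4
  have key := qPoch_ratio_shift_sub (p ^ 2) (d ^ 2 * (p ^ 2) ^ (m + 1)) (b ^ 2) i g4
  rw [qPoch_succ_left, qPoch_succ_left] at g4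
  rw [qPoch_succ] at g1
  rw [qPoch_succ_left] at g2 g3
  have a1 : (p ^ 2) ^ (-((m + 1 : ℕ) : ℤ)) * p ^ 2 = (p ^ 2) ^ (-(m : ℤ)) := by
    rw [← zpow_add_one₀ hq]
    congr 1
    push_cast
    ring
  have a2 : d ^ 2 * (p ^ 2) ^ (m + 1) * p ^ 2 = d ^ 2 * (p ^ 2) ^ (m + 1 + 1) := by ring
  have a3 : (d * p ^ 2) ^ 2 * (p ^ 2) ^ m = d ^ 2 * (p ^ 2) ^ (m + 1 + 1) := by ring
  have a4 : b * p ^ 2 * p = b * p * p ^ 2 := by ring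
  have a5 : d * p ^ 2 * p = d * p * p ^ 2 := by ring
  have a6 : (b * p ^ 2) ^ 2 = b ^ 2 * p ^ 2 * p ^ 2 := by ring
  rw [a2] at key
  rw [a3, a4, a5, a6]
  have split : ∀ N β γ X X' Q D D' C C' t : ℂ, N * β * γ * X / (Q * D * D' * C) * t
      - N * β * γ * X' / (Q * D * D' * C') * t
      = N * β * γ / (Q * D * D') * t * (X / C - X' / C') := by
    intros
    simp only [div_eq_mul_inv, mul_inv]
    ring
  rw [split, key, qPoch_succ_left _ ((p ^ 2) ^ (-((m + 1 : ℕ) : ℤ))), a1, qPoch_succ_left _ b,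
    qPoch_succ_left _ (b * p), qPoch_succ _ (p ^ 2), qPoch_succ_left _ (d * p ^ 2),
    qPoch_succ_left _ (d * p)]
  have c1 : 1 - b ^ 2 = (1 - b) * (1 + b) := by ring
  have c2 : 1 - b ^ 2 * p ^ 2 = (1 - b * p) * (1 + b * p) := by ring
  rw [c1, c2] at g4 ⊢
  simp only [mul_ne_zero_iff] at g1 g2 g3 g4
  obtain ⟨k1, k2⟩ := g1
  obtain ⟨k3, k4⟩ := g2
  obtain ⟨k5, k6⟩ := g3
  obtain ⟨⟨k7, -⟩, ⟨k8, -⟩, k9⟩ := g4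
  generalize qPoch (p ^ 2) (b ^ 2 * p ^ 2 * p ^ 2) i = E at *
  generalize (p ^ 2) ^ (-((m + 1 : ℕ) : ℤ)) = r at *
  generalize 1 - p ^ 2 * (p ^ 2) ^ i = s at *
  generalize 1 - b * p = u at *
  generalize 1 + b * p = u' at *
  generalize 1 - b = v at *
  generalize 1 + b = v' at *
  generalize 1 - d * p ^ 2 = w at *
  generalize 1 - d * p = w' at *
  rw [pow_succ (p ^ 2) i]
  field_simp
  ring
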